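/- arXiv:1202.5711 — 3 statements merged into one kernel-verified Lean document; each statement's English description precedes it below -/
import Mathlib

section
/- Let f ≥ 1 be an integer, let k_1, …, k_f be nonnegative integers, and for each i ∈ {1, …, f} let P_i ∈ M_2(O_E[X_1, …, X_f]) be a matrix of one of the types t1(k_i, X_i), t2(k_i, X_i), t3(k_i, X_i), t4(k_i, X_i). Then the trace of the product P_1·P_2·⋯·P_f does not lie in the ideal p·O_E[X_1, …, X_f] of the polynomial ring O_E[X_1, …, X_f]. -/
/-- A 2×2 matrix over `R` is of one of the four types `t1(m, x)`, `t2(m, x)`, `t3(m, x)`,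
`t4(m, x)`, i.e. it equals `[[p^m, 0], [x, 1]]`, `[[x, 1], [p^m, 0]]`, `[[1, x], [0, p^m]]`
or `[[0, p^m], [1, x]]` respectively. -/
def IsTypeMatrix {R : Type*} [CommRing R] (p m : ℕ) (x : R)
    (P : Matrix (Fin 2) (Fin 2) R) : Prop :=
  P = !![(p : R) ^ m, 0; x, 1] ∨ P = !![x, 1; (p : R) ^ m, 0] ∨
  P = !![1, x; 0, (p : R) ^ m] ∨ P = !![0, (p : R) ^ m; 1, x]

open Polynomial in
/-- The `d`-th coefficients of the entries of `Q`, which have degree at most `d`, form the image of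
a matrix of natural numbers whose row sums are at most `1` and whose entry at `(r, c)` is `1`. -/
def HasSubstochasticTop {κ : Type*} [CommRing κ] (d : ℕ) (r c : Fin 2)
    (Q : Matrix (Fin 2) (Fin 2) κ[X]) : Prop :=
  ∃ N : Matrix (Fin 2) (Fin 2) ℕ,
    (∀ i j, (Q i j).natDegree ≤ d ∧ (Q i j).coeff d = (N i j : κ)) ∧
    (∀ i, N i 0 + N i 1 ≤ 1) ∧ N r c = 1

namespace HasSubstochasticTop

open Polynomial

variable {κ : Type*} [CommRing κ]

theorem one (r : Fin 2) : HasSubstochasticTop 0 r r (1 : Matrix (Fin 2) (Fin 2) κ[X]) := by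
  refine ⟨1, fun i j => ?_, ?_, by simp⟩
  · by_cases h : i = j <;> simp [h, Matrix.one_apply]
  · decide

theorem mul {d e : ℕ} {r s c : Fin 2} {Q Q' : Matrix (Fin 2) (Fin 2) κ[X]}
    (h : HasSubstochasticTop d r s Q) (h' : HasSubstochasticTop e s c Q') :
    HasSubstochasticTop (d + e) r c (Q * Q') := by
  obtain ⟨N, hN, hrow, hrs⟩ := h
  obtain ⟨N', hN', hrow', hsc⟩ := h'
  have hsum : ∀ i, (N * N') i 0 + (N * N') i 1 ≤ 1 := by
    intro i
    simp only [Matrix.mul_apply, Fin.sum_univ_two]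
    have h0 := Nat.mul_le_mul_left (N i 0) (hrow' 0)
    have h1 := Nat.mul_le_mul_left (N i 1) (hrow' 1)
    linarith [hrow i]
  refine ⟨N * N', fun i j => ⟨?_, ?_⟩, hsum, le_antisymm ?_ ?_⟩
  · rw [Matrix.mul_apply]
    exact natDegree_sum_le_of_forall_le _ _ fun k _ =>
      natDegree_mul_le_of_le (hN i k).1 (hN' k j).1
  · rw [Matrix.mul_apply, Matrix.mul_apply, finsetSum_coeff, Nat.cast_sum]
    refine Finset.sum_congr rfl fun k _ => ?_
    rw [coeff_mul_add_eq_of_natDegree_le (hN i k).1 (hN' k j).1, (hN i k).2, (hN' k j).2,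
      Nat.cast_mul]
  · have := hsum r
    fin_cases c <;> simp only [Fin.zero_eta, Fin.mk_one] <;> omega
  · calc 1 = N r s * N' s c := by rw [hrs, hsc]
      _ ≤ (N * N') r c := by
        rw [Matrix.mul_apply]
        exact Finset.single_le_sum (f := fun k => N r k * N' k c)
          (fun _ _ => Nat.zero_le _) (Finset.mem_univ s)

theorem prod_ofFn {n : ℕ} (Q : Fin n → Matrix (Fin 2) (Fin 2) κ[X]) (r : Fin (n + 1) → Fin 2)
    (h : ∀ i, ∃ d, HasSubstochasticTop d (r i.castSucc) (r i.succ) (Q i)) :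
    ∃ d, HasSubstochasticTop d (r 0) (r (Fin.last n)) (List.ofFn Q).prod := by
  induction n with
  | zero => exact ⟨0, by simpa using one _⟩
  | succ n ih =>
    obtain ⟨d, hd⟩ := h 0
    obtain ⟨e, he⟩ := ih (fun i => Q i.succ) (fun i => r i.succ) fun i => h i.succ
    refine ⟨d + e, ?_⟩
    rw [List.ofFn_succ, List.prod_cons]
    exact hd.mul he

theorem trace_ne_zero {d : ℕ} {r : Fin 2} {Q : Matrix (Fin 2) (Fin 2) κ[X]}
    (h : HasSubstochasticTop d r r Q) (h1 : (1 : κ) ≠ 0) (h2 : (2 : κ) ≠ 0) :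
    Q.trace ≠ 0 := by
  obtain ⟨N, hN, hrow, hr⟩ := h
  intro h0
  have hc : ((N 0 0 + N 1 1 : ℕ) : κ) = 0 := by
    rw [Nat.cast_add, ← (hN 0 0).2, ← (hN 1 1).2, ← coeff_add, ← Matrix.trace_fin_two, h0,
      coeff_zero]
  have h12 : N 0 0 + N 1 1 = 1 ∨ N 0 0 + N 1 1 = 2 := by
    have := hrow 0
    have := hrow 1
    fin_cases r <;> simp only [Fin.zero_eta, Fin.mk_one] at hr <;> omega
  rcases h12 with h | h <;> rw [h] at hc
  · exact h1 (by simpa using hc)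
  · exact h2 (by simpa using hc)

end HasSubstochasticTop

open Polynomial in
theorem IsTypeMatrix.exists_hasSubstochasticTop {R κ : Type*} [CommRing R] [CommRing κ]
    {p m : ℕ} (hp : (p : κ) = 0) {x : R} {P : Matrix (Fin 2) (Fin 2) R}
    (hP : IsTypeMatrix p m x P) :
    ∃ r, ∀ c, ∃ s : κ[X], ∀ φ : R →+* κ[X], φ x = s →
      ∃ d, HasSubstochasticTop d r c (φ.mapMatrix P) := by
  obtain ⟨a, ha, hpa⟩ : ∃ a : ℕ, a ≤ 1 ∧ (p : κ[X]) ^ m = (a : κ[X]) := by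
    have hp' : (p : κ[X]) = 0 := by rw [← C_eq_natCast, hp, C_0]
    rcases m with _ | m
    · exact ⟨1, le_rfl, by simp⟩
    · exact ⟨0, Nat.zero_le _, by simp [hp']⟩
  have hφ (φ : R →+* κ[X]) : φ ((p : R) ^ m) = (a : κ[X]) := by rw [map_pow, map_natCast, hpa]
  have hdeg : (X : κ[X]).natDegree ≤ 1 := natDegree_X_le
  have hca : (a : κ[X]).coeff 1 = 0 := by
    rw [← C_eq_natCast, coeff_C_succ]
  rcases hP with rfl | rfl | rfl | rfl
  · refine ⟨1, fun c => ?_⟩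
    fin_cases c
    · refine ⟨X, fun φ hx => ⟨1, !![0, 0; 1, 0], fun i j => ?_, by decide, rfl⟩⟩
      fin_cases i <;> fin_cases j <;> simp [hx, hφ, hca, hdeg, coeff_one, -map_pow]
    · refine ⟨0, fun φ hx => ⟨0, !![a, 0; 0, 1], fun i j => ?_, fun i => ?_, rfl⟩⟩
      · fin_cases i <;> fin_cases j <;> simp [hx, hφ, -map_pow]
      · fin_cases i <;> simp [ha]
  · refine ⟨0, fun c => ?_⟩
    fin_cases c
    · refine ⟨X, fun φ hx => ⟨1, !![1, 0; 0, 0], fun i j => ?_, by decide, rfl⟩⟩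
      fin_cases i <;> fin_cases j <;> simp [hx, hφ, hca, hdeg, coeff_one, -map_pow]
    · refine ⟨0, fun φ hx => ⟨0, !![0, 1; a, 0], fun i j => ?_, fun i => ?_, rfl⟩⟩
      · fin_cases i <;> fin_cases j <;> simp [hx, hφ, -map_pow]
      · fin_cases i <;> simp [ha]
  · refine ⟨0, fun c => ?_⟩
    fin_cases c
    · refine ⟨0, fun φ hx => ⟨0, !![1, 0; 0, a], fun i j => ?_, fun i => ?_, rfl⟩⟩
      · fin_cases i <;> fin_cases j <;> simp [hx, hφ, -map_pow]
      · fin_cases i <;> simp [ha]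
    · refine ⟨X, fun φ hx => ⟨1, !![0, 1; 0, 0], fun i j => ?_, by decide, rfl⟩⟩
      fin_cases i <;> fin_cases j <;> simp [hx, hφ, hca, hdeg, coeff_one, -map_pow]
  · refine ⟨1, fun c => ?_⟩
    fin_cases c
    · refine ⟨0, fun φ hx => ⟨0, !![0, a; 1, 0], fun i j => ?_, fun i => ?_, rfl⟩⟩
      · fin_cases i <;> fin_cases j <;> simp [hx, hφ, -map_pow]
      · fin_cases i <;> simp [ha]
    · refine ⟨X, fun φ hx => ⟨1, !![0, 0; 0, 1], fun i j => ?_, by decide, rfl⟩⟩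
      fin_cases i <;> fin_cases j <;> simp [hx, hφ, hca, hdeg, coeff_one, -map_pow]

/-- The trace of a cyclic product of type matrices in independent variables is not divisible by
`p`, over any ring in which the odd number `p` is not a unit. -/
theorem trace_prod_notMem_span_of_not_isUnit {R : Type*} [CommRing R] {p : ℕ} (hodd : Odd p)
    (hunit : ¬ IsUnit (p : R)) {n : ℕ} (k : Fin (n + 1) → ℕ)
    (P : Fin (n + 1) → Matrix (Fin 2) (Fin 2) (MvPolynomial (Fin (n + 1)) R))
    (hP : ∀ i, IsTypeMatrix p (k i) (MvPolynomial.X i) (P i)) :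
    Matrix.trace (List.ofFn P).prod ∉ Ideal.span {(p : MvPolynomial (Fin (n + 1)) R)} := by
  intro hmem
  let q : R →+* R ⧸ Ideal.span {(p : R)} := Ideal.Quotient.mk _
  have hp : (p : R ⧸ Ideal.span {(p : R)}) = 0 := by
    rw [← map_natCast q]
    exact Ideal.Quotient.eq_zero_iff_mem.2 (Ideal.mem_span_singleton_self _)
  have h1 : (1 : R ⧸ Ideal.span {(p : R)}) ≠ 0 := by
    have : Nontrivial (R ⧸ Ideal.span {(p : R)}) :=
      Ideal.Quotient.nontrivial_iff.2 (by rwa [Ne, Ideal.span_singleton_eq_top])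
    exact one_ne_zero
  have h2 : (2 : R ⧸ Ideal.span {(p : R)}) ≠ 0 := by
    intro h2
    obtain ⟨t, rfl⟩ := hodd
    apply h1
    rw [← hp]
    push_cast
    rw [h2]
    ring
  choose r hr using fun i => (hP i).exists_hasSubstochasticTop hp
  let r' : Fin (n + 2) → Fin 2 := Fin.snoc r (r 0)
  choose s hs using fun i : Fin (n + 1) => hr i (r' i.succ)
  let φ := MvPolynomial.eval₂Hom (Polynomial.C.comp q) s
  obtain ⟨d, hd⟩ := HasSubstochasticTop.prod_ofFn (fun i => φ.mapMatrix (P i)) r' fun i => by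
    have := hs i φ (by simp [φ])
    rwa [← Fin.snoc_castSucc (α := fun _ => Fin 2) (r 0) r i] at this
  have hends : r' 0 = r' (Fin.last (n + 1)) := by
    refine Eq.trans ?_ (Fin.snoc_last (α := fun _ => Fin 2) (r 0) r).symm
    exact Fin.snoc_castSucc (α := fun _ => Fin 2) (r 0) r 0
  rw [← hends] at hd
  refine hd.trace_ne_zero h1 h2 ?_
  have hprod : (List.ofFn fun i => φ.mapMatrix (P i)).prod = φ.mapMatrix (List.ofFn P).prod := by
    rw [map_list_prod, List.map_ofFn]
    rfl
  rw [hprod, RingHom.mapMatrix_apply, ← AddMonoidHom.map_trace φ]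
  obtain ⟨g, hg⟩ := Ideal.mem_span_singleton.1 hmem
  rw [hg, map_mul, map_natCast, ← Polynomial.C_eq_natCast, hp, Polynomial.C_0, zero_mul]

theorem not_isUnit_natCast_of_eq_integralClosure (p : ℕ) [Fact p.Prime] {E : Type*} [Field E]
    [Algebra ℚ_[p] E] [Algebra ℤ_[p] E] [IsScalarTower ℤ_[p] ℚ_[p] E]
    (O : Subalgebra ℤ_[p] E) (hO : O = integralClosure ℤ_[p] E) : ¬ IsUnit (p : O) := by
  intro h
  have hinj : Function.Injective (algebraMap ℤ_[p] O) := by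
    apply Function.Injective.of_comp (f := algebraMap O E)
    rw [← RingHom.coe_comp, ← IsScalarTower.algebraMap_eq,
      IsScalarTower.algebraMap_eq ℤ_[p] ℚ_[p] E, RingHom.coe_comp]
    exact (algebraMap ℚ_[p] E).injective.comp (IsFractionRing.injective ℤ_[p] ℚ_[p])
  have hint : Algebra.IsIntegral ℤ_[p] O := by
    subst hO
    infer_instance
  have : FaithfulSMul ℤ_[p] O := (faithfulSMul_iff_algebraMap_injective _ _).2 hinj
  rw [← map_natCast (algebraMap ℤ_[p] O)] at h
  exact PadicInt.prime_p.not_isUnit (isUnit_of_map_unit _ _ h)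

/-- Let `p` be an odd prime, `E` a finite extension of `ℚ_p`, and `O` its
ring of integers (the integral closure of `ℤ_p` in `E`).  Let `f ≥ 1`, let `k_1, …, k_f` be
nonnegative integers, and for each `i` let `P i ∈ M_2(O[X_1, …, X_f])` be a matrix of one of
the types `t1(k_i, X_i)`, …, `t4(k_i, X_i)`.  Then the trace of the ordered product
`P_1 ⋯ P_f` does not lie in the ideal `p · O[X_1, …, X_f]`. -/
theorem statement4 (p : ℕ) [Fact p.Prime] (hp : p ≠ 2)
    (E : Type*) [Field E] [Algebra ℚ_[p] E] [FiniteDimensional ℚ_[p] E]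
    [Algebra ℤ_[p] E] [IsScalarTower ℤ_[p] ℚ_[p] E]
    (O : Subalgebra ℤ_[p] E) (hO : O = integralClosure ℤ_[p] E)
    (f : ℕ) (hf : 1 ≤ f) (k : Fin f → ℕ)
    (P : Fin f → Matrix (Fin 2) (Fin 2) (MvPolynomial (Fin f) O))
    (hP : ∀ i, IsTypeMatrix p (k i) (MvPolynomial.X i) (P i)) :
    Matrix.trace (List.ofFn P).prod ∉
      Ideal.span {(p : MvPolynomial (Fin f) O)} := by
  obtain ⟨n, rfl⟩ := Nat.exists_eq_add_of_le' hf
  exact trace_prod_notMem_span_of_not_isUnit ((Fact.out : p.Prime).odd_of_ne_two hp)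
    (not_isUnit_natCast_of_eq_integralClosure p O hO) k P hP
end

section
/- Let f ≥ 1 be an integer, let k_1, …, k_f be nonnegative integers, and for each i ∈ {1, …, f} let P_i ∈ M_2(O_E[X_1, …, X_f]) be a matrix of one of the types t1(k_i, X_i), t2(k_i, X_i), t3(k_i, X_i), t4(k_i, X_i). Set Q_f := P_1·P_2·⋯·P_f. Assume that the trace of Q_f is not a constant polynomial (i.e. Tr(Q_f) ∉ O_E) and that Tr(Q_f) lies in the ideal of O_E[X_1, …, X_f] generated by p, X_1, …, X_f. Then for any matrices A_1, …, A_f ∈ M_2(O_E) all of whose entries lie in p·O_E, the trace of Q_f^A := (Id + A_1)·P_1·(Id + A_2)·P_2·⋯·(Id + A_f)·P_f is not a constant polynomial, i.e. Tr(Q_f^A) ∉ O_E. -/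
open MvPolynomial

/-- The `2 × 2` matrix of type `t1`, …, `t4` (indexed by `t = 0, …, 3`) with `a` in place of the
power of `p`. -/
def typeMatrix {R : Type*} [CommRing R] (t : Fin 4) (a x : R) : Matrix (Fin 2) (Fin 2) R :=
  ![!![a, 0; x, 1], !![x, 1; a, 0], !![1, x; 0, a], !![0, a; 1, x]] t

/-- The matrix multiplying the variable in a matrix of type `t`. -/
def typeUnit (t : Fin 4) : Matrix (Fin 2) (Fin 2) ℤ :=
  ![!![0, 0; 1, 0], !![1, 0; 0, 0], !![0, 1; 0, 0], !![0, 0; 0, 1]] t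

theorem IsTypeMatrix.exists_eq_typeMatrix {R : Type*} [CommRing R] {p m : ℕ} {x : R}
    {P : Matrix (Fin 2) (Fin 2) R} (h : IsTypeMatrix p m x P) :
    ∃ t, P = typeMatrix t ((p : R) ^ m) x := by
  rcases h with h | h | h | h
  exacts [⟨0, h⟩, ⟨1, h⟩, ⟨2, h⟩, ⟨3, h⟩]

theorem typeMatrix_map {R S : Type*} [CommRing R] [CommRing S] (φ : R →+* S) (t : Fin 4)
    (a x : R) : φ.mapMatrix (typeMatrix t a x) = typeMatrix t (φ a) (φ x) := by
  ext i j
  fin_cases t <;> fin_cases i <;> fin_cases j <;> simp [typeMatrix]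

theorem typeMatrix_C_X {σ : Type*} (t : Fin 4) (a : ℤ) (i : σ) :
    typeMatrix t (C a) (X i : MvPolynomial σ ℤ) =
      (typeMatrix t a 0).map C + (X i : MvPolynomial σ ℤ) • (typeUnit t).map C := by
  ext r c
  fin_cases t <;> fin_cases r <;> fin_cases c <;> simp [typeMatrix, typeUnit]

/-- A `2 × 2` integer matrix with nonnegative entries and all row and column sums at most `1`. -/
def IsSubpermutation (N : Matrix (Fin 2) (Fin 2) ℤ) : Prop :=
  (∀ i j, 0 ≤ N i j) ∧ (∀ i, N i 0 + N i 1 ≤ 1) ∧ ∀ j, N 0 j + N 1 j ≤ 1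

namespace IsSubpermutation

theorem mul {M N : Matrix (Fin 2) (Fin 2) ℤ} (hM : IsSubpermutation M)
    (hN : IsSubpermutation N) : IsSubpermutation (M * N) := by
  obtain ⟨hM0, hMr, hMc⟩ := hM
  obtain ⟨hN0, hNr, hNc⟩ := hN
  refine ⟨fun i j => ?_, fun i => ?_, fun j => ?_⟩ <;>
    simp only [Matrix.mul_apply, Fin.sum_univ_two]
  · nlinarith [mul_nonneg (hM0 i 0) (hN0 0 j), mul_nonneg (hM0 i 1) (hN0 1 j)]
  · nlinarith [mul_le_mul_of_nonneg_left (hNr 0) (hM0 i 0),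
      mul_le_mul_of_nonneg_left (hNr 1) (hM0 i 1), hMr i]
  · nlinarith [mul_le_mul_of_nonneg_right (hMc 0) (hN0 0 j),
      mul_le_mul_of_nonneg_right (hMc 1) (hN0 1 j), hNc j]

theorem zero : IsSubpermutation 0 := by simp [IsSubpermutation]

theorem one : IsSubpermutation 1 := by simp [IsSubpermutation, Fin.forall_fin_two]

theorem typeUnit (t : Fin 4) : IsSubpermutation (typeUnit t) := by
  fin_cases t <;> simp [IsSubpermutation, _root_.typeUnit, Fin.forall_fin_two]

theorem typeMatrix (t : Fin 4) (k : ℕ) : IsSubpermutation (typeMatrix t (0 ^ k) 0) := by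
  rcases k.eq_zero_or_pos with rfl | hk
  · fin_cases t <;> simp [IsSubpermutation, _root_.typeMatrix, Fin.forall_fin_two]
  · fin_cases t <;>
      simp [IsSubpermutation, _root_.typeMatrix, Fin.forall_fin_two, zero_pow hk.ne']

theorem trace_eq_zero_or_one {N : Matrix (Fin 2) (Fin 2) ℤ} (hN : IsSubpermutation N)
    (hdet : N.det = 0) : N.trace = 0 ∨ N.trace = 1 := by
  obtain ⟨h0, hr, hc⟩ := hN
  rw [Matrix.det_fin_two] at hdet
  rw [Matrix.trace_fin_two]
  have h00 := h0 0 0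
  have h01 := h0 0 1
  have h10 := h0 1 0
  have h11 := h0 1 1
  have hr0 := hr 0
  have hr1 := hr 1
  by_contra hne
  have ha : N 0 0 = 1 := by omega
  have hd : N 1 1 = 1 := by omega
  have hb : N 0 1 = 0 := by omega
  simp [ha, hd, hb] at hdet

end IsSubpermutation

theorem det_typeUnit (t : Fin 4) : (typeUnit t).det = 0 := by
  fin_cases t <;> simp [typeUnit, Matrix.det_fin_two]

theorem det_typeMatrix_zero {R : Type*} [CommRing R] (t : Fin 4) (x : R) :
    (typeMatrix t 0 x).det = 0 := by
  fin_cases t <;> simp [typeMatrix, Matrix.det_fin_two]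

theorem coeff_map_C_mul {σ : Type*} (B : Matrix (Fin 2) (Fin 2) ℤ)
    (M : Matrix (Fin 2) (Fin 2) (MvPolynomial σ ℤ)) (d : σ →₀ ℕ) :
    (B.map C * M).map (coeff d) = B * M.map (coeff d) := by
  ext r c
  simp only [Matrix.map_apply, Matrix.mul_apply, Fin.sum_univ_two, coeff_add, coeff_C_mul]

theorem coeff_typeMatrix_mul {σ : Type*} [DecidableEq σ] (t : Fin 4) (a : ℤ) (i : σ)
    (M : Matrix (Fin 2) (Fin 2) (MvPolynomial σ ℤ)) (d : σ →₀ ℕ) :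
    (typeMatrix t (C a) (X i) * M).map (coeff d) =
      typeMatrix t a 0 * M.map (coeff d) +
        if d i = 0 then 0 else typeUnit t * M.map (coeff (d - Finsupp.single i 1)) := by
  rw [typeMatrix_C_X, add_mul, Matrix.smul_mul, Matrix.map_add _ (fun a b => coeff_add d a b),
    coeff_map_C_mul]
  congr 1
  split_ifs with h
  · ext r c
    simp [coeff_X_mul', h]
  · rw [← coeff_map_C_mul]
    ext r c
    simp [coeff_X_mul', h]

/-- The coefficient matrices of a product of type matrices in distinct variables, the powers of
`p` being replaced by powers of `0`, are subpermutation matrices. -/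
theorem coeff_prod_typeMatrix {σ : Type*} [DecidableEq σ] (t : σ → Fin 4) (k : σ → ℕ)
    (l : List σ) (hl : l.Nodup) (d : σ →₀ ℕ) :
    let N := ((l.map fun i =>
      typeMatrix (t i) (C (0 ^ k i)) (X i : MvPolynomial σ ℤ)).prod).map (coeff d)
    IsSubpermutation N ∧ (∀ j ∉ l, d j ≠ 0 → N = 0) ∧
      ((d ≠ 0 ∨ ∃ i ∈ l, k i ≠ 0) → N.det = 0) := by
  induction l generalizing d with
  | nil =>
    by_cases hd : d = 0
    · subst hd
      have h1 : (1 : Matrix (Fin 2) (Fin 2) (MvPolynomial σ ℤ)).map (coeff 0) = 1 := by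
        ext r c
        by_cases h : r = c <;> simp [Matrix.one_apply, h]
      simp [h1, IsSubpermutation.one]
    · have h0 : (1 : Matrix (Fin 2) (Fin 2) (MvPolynomial σ ℤ)).map (coeff d) = 0 := by
        ext r c
        by_cases h : r = c <;> simp [h, coeff_one, Ne.symm hd]
      simp [h0, IsSubpermutation.zero]
  | cons i l ih =>
    obtain ⟨hi, hl⟩ := List.nodup_cons.1 hl
    have ih := ih hl
    simp only [List.map_cons, List.prod_cons, coeff_typeMatrix_mul] at ih ⊢
    by_cases hdi : d i = 0
    · obtain ⟨hsub, hvan, hdet⟩ := ih d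
      simp only [hdi, if_true, add_zero]
      refine ⟨(IsSubpermutation.typeMatrix _ _).mul hsub, fun j hj hdj => ?_, fun h => ?_⟩
      · rw [hvan j (fun h => hj (List.mem_cons_of_mem _ h)) hdj, mul_zero]
      · rw [Matrix.det_mul]
        by_cases hki : k i = 0
        · rw [hdet, mul_zero]
          refine h.imp_right ?_
          rintro ⟨j, hj, hkj⟩
          rcases List.mem_cons.1 hj with rfl | hj
          exacts [absurd hki hkj, ⟨j, hj, hkj⟩]
        · rw [zero_pow hki, det_typeMatrix_zero, zero_mul]
    · obtain ⟨hsub, hvan, -⟩ := ih (d - Finsupp.single i 1)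
      simp only [hdi, if_false, (ih d).2.1 i hi hdi, mul_zero, zero_add]
      refine ⟨(IsSubpermutation.typeUnit _).mul hsub, fun j hj hdj => ?_, fun _ => ?_⟩
      · rw [List.mem_cons, not_or] at hj
        rw [hvan j hj.2 (by simpa [Finsupp.single_apply, Ne.symm hj.1] using hdj), mul_zero]
      · rw [Matrix.det_mul, det_typeUnit, zero_mul]

/-- A product of type matrices evaluated at `1` has nonnegative entries and a positive row. -/
theorem exists_row_pos_prod_typeMatrix {σ : Type*} (t : σ → Fin 4) (a : σ → ℤ)
    (ha : ∀ i, 0 ≤ a i) (l : List σ) (hl : l ≠ []) :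
    (∀ r c, 0 ≤ (l.map fun i => typeMatrix (t i) (a i) 1).prod r c) ∧
      ∃ r, ∀ c, 0 < (l.map fun i => typeMatrix (t i) (a i) 1).prod r c := by
  have base : ∀ (s : Fin 4) (b : ℤ), 0 ≤ b → (∀ r c, 0 ≤ typeMatrix s b 1 r c) ∧
      ∃ r, ∀ c, 0 < typeMatrix s b 1 r c := by
    intro s b hb
    fin_cases s <;> simp [typeMatrix, Fin.forall_fin_two, Fin.exists_fin_two, hb]
  induction l with
  | nil => exact absurd rfl hl
  | cons i l ih =>
    obtain ⟨h0, r, hr⟩ := base (t i) (a i) (ha i)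
    rcases eq_or_ne l [] with rfl | hl'
    · simpa using base (t i) (a i) (ha i)
    · obtain ⟨g0, s, hs⟩ := ih hl'
      simp only [List.map_cons, List.prod_cons, Matrix.mul_apply]
      exact ⟨fun x c => Finset.sum_nonneg fun y _ => mul_nonneg (h0 x y) (g0 y c),
        r, fun c => Finset.sum_pos' (fun y _ => mul_nonneg (h0 r y) (g0 y c))
          ⟨s, Finset.mem_univ _, mul_pos (hr s) (hs c)⟩⟩

theorem map_trace_prod_typeMatrix {R S ι : Type*} [CommRing R] [CommRing S] (φ : R →+* S)
    (t : ι → Fin 4) (a x : ι → R) (l : List ι) :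
    φ (l.map fun i => typeMatrix (t i) (a i) (x i)).prod.trace =
      (l.map fun i => typeMatrix (t i) (φ (a i)) (φ (x i))).prod.trace := by
  rw [AddMonoidHom.map_trace φ]
  change (φ.mapMatrix _).trace = _
  rw [map_list_prod, List.map_map]
  congr 3
  ext1 i
  exact typeMatrix_map φ _ _ _

theorem trace_prod_typeMatrix_ne_zero {σ : Type*} (t : σ → Fin 4) (k : σ → ℕ) (l : List σ)
    (hl : l ≠ []) :
    (l.map fun i => typeMatrix (t i) (C (0 ^ k i)) (X i : MvPolynomial σ ℤ)).prod.trace ≠ 0 := by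
  intro h
  have h' := congrArg (eval fun _ => (1 : ℤ)) h
  rw [map_trace_prod_typeMatrix] at h'
  simp only [eval_C, eval_X, map_zero] at h'
  obtain ⟨h0, r, hr⟩ := exists_row_pos_prod_typeMatrix t (fun i => (0 : ℤ) ^ k i)
    (fun i => pow_nonneg le_rfl _) l hl
  exact (Finset.sum_pos' (fun i _ => h0 i i) ⟨r, Finset.mem_univ _, hr r⟩).ne' h'

theorem coeff_trace_prod_typeMatrix {σ : Type*} (t : σ → Fin 4) (k : σ → ℕ) (l : List σ)
    (hl : l.Nodup) (d : σ →₀ ℕ) (h : d ≠ 0 ∨ ∃ i ∈ l, k i ≠ 0) :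
    let c := coeff d
      (l.map fun i => typeMatrix (t i) (C (0 ^ k i)) (X i : MvPolynomial σ ℤ)).prod.trace
    c = 0 ∨ c = 1 := by
  classical
  obtain ⟨hsub, -, hdet⟩ := coeff_prod_typeMatrix t k l hl d
  simpa [Matrix.trace_fin_two] using hsub.trace_eq_zero_or_one (hdet h)

/-- A product of type matrices with nonconstant trace in the ideal `(p, X_1, …, X_f)` keeps a
nonconstant trace when it is perturbed by matrices congruent to the identity modulo `p`. -/
theorem trace_perturbed_prod_not_constant {O : Type*} [CommRing O] (p : ℕ)
    (hp : ¬ IsUnit (p : O)) {f : ℕ} (hf : 1 ≤ f) (k : Fin f → ℕ) (t : Fin f → Fin 4)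
    (htr : (List.ofFn fun i => typeMatrix (t i) ((p : MvPolynomial (Fin f) O) ^ k i)
      (X i)).prod.trace ∉ Set.range (C : O → MvPolynomial (Fin f) O))
    (htr' : (List.ofFn fun i => typeMatrix (t i) ((p : MvPolynomial (Fin f) O) ^ k i)
      (X i)).prod.trace ∈ Ideal.span (insert (p : MvPolynomial (Fin f) O) (Set.range X)))
    (A : Fin f → Matrix (Fin 2) (Fin 2) O) (hA : ∀ i a b, (p : O) ∣ A i a b) :
    (List.ofFn fun i => (1 + A i).map (C : O → MvPolynomial (Fin f) O) *
      typeMatrix (t i) ((p : MvPolynomial (Fin f) O) ^ k i) (X i)).prod.trace ∉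
      Set.range (C : O → MvPolynomial (Fin f) O) := by
  rintro ⟨c, hc⟩
  simp only [List.ofFn_eq_map] at htr htr' hc
  set q := Ideal.Quotient.mk (Ideal.span {(p : O)})
  have hqp : q p = 0 := Ideal.Quotient.eq_zero_iff_mem.2 (Ideal.mem_span_singleton_self _)
  have : Nontrivial (O ⧸ Ideal.span {(p : O)}) :=
    Ideal.Quotient.nontrivial_iff.2 (by rwa [Ne, Ideal.span_singleton_eq_top])
  have hl : List.finRange f ≠ [] := by
    rw [Ne, List.finRange_eq_nil_iff]
    omega
  set τ : MvPolynomial (Fin f) ℤ := ((List.finRange f).map fun i =>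
    typeMatrix (t i) (C (0 ^ k i)) (X i)).prod.trace with hτ
  have hτ0 : τ ≠ 0 := trace_prod_typeMatrix_ne_zero t k _ hl
  have hτq : map (Int.castRingHom (O ⧸ Ideal.span {(p : O)})) τ =
      map q ((List.finRange f).map fun i =>
        typeMatrix (t i) ((p : MvPolynomial (Fin f) O) ^ k i) (X i)).prod.trace := by
    rw [hτ, map_trace_prod_typeMatrix, map_trace_prod_typeMatrix]
    have : (p : MvPolynomial (Fin f) (O ⧸ Ideal.span {(p : O)})) = 0 := by
      rw [← C_eq_coe_nat, ← map_natCast q, hqp, C_0]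
    simp [this]
  have hτc : map (Int.castRingHom (O ⧸ Ideal.span {(p : O)})) τ = C (q c) := by
    rw [hτq, ← map_C, hc, AddMonoidHom.map_trace (map q), AddMonoidHom.map_trace (map q)]
    change ((map q).mapMatrix _).trace = ((map q).mapMatrix _).trace
    rw [map_list_prod, map_list_prod, List.map_map, List.map_map]
    congr 3
    ext1 i
    have h1 : (map q).mapMatrix ((1 + A i).map (C : O → MvPolynomial (Fin f) O)) = 1 := by
      ext1 r s
      have : q (A i r s) = 0 :=
        Ideal.Quotient.eq_zero_iff_mem.2 (Ideal.mem_span_singleton.2 (hA i r s))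
      by_cases h : r = s <;> simp [Matrix.one_apply, h, this]
      subst h
      simp [this]
    simp only [Function.comp_apply, map_mul, h1, one_mul]
  have hcoeff : ∀ d : Fin f →₀ ℕ, d ≠ 0 → coeff d τ = 0 := by
    intro d hd
    refine (coeff_trace_prod_typeMatrix t k _ (List.nodup_finRange f) d
      (.inl hd)).resolve_right fun h => ?_
    have := congrArg (coeff d) hτc
    rw [coeff_map, hτ, h, coeff_C, if_neg hd.symm] at this
    simp at this
  have hτC : τ = C (coeff 0 τ) := by
    ext d
    rw [coeff_C]
    split_ifs with h
    · rw [h]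
    · exact hcoeff d (Ne.symm h)
  by_cases hk : ∃ i, k i ≠ 0
  · have hconst : q (constantCoeff ((List.finRange f).map fun i =>
        typeMatrix (t i) ((p : MvPolynomial (Fin f) O) ^ k i) (X i)).prod.trace) = 0 := by
      have hle : Ideal.span (insert (p : MvPolynomial (Fin f) O) (Set.range X)) ≤
          RingHom.ker (q.comp constantCoeff) := by
        rw [Ideal.span_le]
        rintro _ (rfl | ⟨i, rfl⟩) <;> simp [RingHom.mem_ker, -map_natCast]
        simpa using hqp
      exact hle htr'
    obtain ⟨i, hi⟩ := hk
    rcases coeff_trace_prod_typeMatrix t k _ (List.nodup_finRange f) 0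
      (.inr ⟨i, List.mem_finRange i, hi⟩) with h | h
    · rw [hτC, hτ, h, C_0] at hτ0
      exact hτ0 rfl
    · have := congrArg (coeff 0) hτq
      rw [coeff_map, coeff_map, hτ, h] at this
      rw [constantCoeff_eq] at hconst
      rw [hconst] at this
      simp at this
  · push Not at hk
    refine htr ⟨Int.castRingHom O (coeff 0 τ), ?_⟩
    have := congrArg (map (Int.castRingHom O)) hτC
    nth_rewrite 1 [hτ] at this
    rw [map_C, map_trace_prod_typeMatrix] at this
    simp only [hk, pow_zero, map_one, map_X] at this ⊢
    exact this.symm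

theorem not_isUnit_natCast_integralClosure (p : ℕ) [Fact p.Prime] (E : Type*) [Field E]
    [Algebra ℚ_[p] E] [Algebra ℤ_[p] E] [IsScalarTower ℤ_[p] ℚ_[p] E] :
    ¬ IsUnit (p : integralClosure ℤ_[p] E) := by
  intro h
  obtain ⟨x, hx⟩ := h.exists_right_inv
  have hxE : (p : E) * x = 1 := by simpa using congrArg Subtype.val hx
  have hxp : (x : E) = algebraMap ℚ_[p] E (p : ℚ_[p])⁻¹ := by
    rw [map_inv₀, map_natCast]
    exact eq_inv_of_mul_eq_one_right hxE
  have hint : IsIntegral ℤ_[p] (x : E) := x.2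
  rw [hxp, isIntegral_algebraMap_iff (algebraMap ℚ_[p] E).injective,
    IsIntegrallyClosed.isIntegral_iff] at hint
  obtain ⟨y, hy⟩ := hint
  have hp0 : (p : ℚ_[p]) ≠ 0 := by exact_mod_cast (Fact.out : p.Prime).ne_zero
  refine PadicInt.p_nonunit (p := p) (IsUnit.of_mul_eq_one y ?_)
  apply PadicInt.ext
  rw [PadicInt.coe_mul, PadicInt.coe_natCast, show (y : ℚ_[p]) = (p : ℚ_[p])⁻¹ from hy,
    mul_inv_cancel₀ hp0, PadicInt.coe_one]

/-- Let `p` be an odd prime, `E` a finite extension of `ℚ_p`, `O` its ring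
of integers.  Let `f ≥ 1`, `k_1, …, k_f ≥ 0`, and for each `i` let
`P i ∈ M_2(O[X_1, …, X_f])` be of one of the types `t1(k_i, X_i)`, …, `t4(k_i, X_i)`.
Set `Q_f := P_1 ⋯ P_f`.  Assume `Tr(Q_f)` is not a constant polynomial and that `Tr(Q_f)`
lies in the ideal generated by `p, X_1, …, X_f`.  Then for any matrices
`A_1, …, A_f ∈ M_2(O)` with all entries in `p · O`, the trace of
`Q_f^A := (Id + A_1)·P_1·(Id + A_2)·P_2 ⋯ (Id + A_f)·P_f` is not a constant polynomial. -/
theorem statement5 (p : ℕ) [Fact p.Prime] (hp : p ≠ 2)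
    (E : Type*) [Field E] [Algebra ℚ_[p] E] [FiniteDimensional ℚ_[p] E]
    [Algebra ℤ_[p] E] [IsScalarTower ℤ_[p] ℚ_[p] E]
    (O : Subalgebra ℤ_[p] E) (hO : O = integralClosure ℤ_[p] E)
    (f : ℕ) (hf : 1 ≤ f) (k : Fin f → ℕ)
    (P : Fin f → Matrix (Fin 2) (Fin 2) (MvPolynomial (Fin f) O))
    (hP : ∀ i, IsTypeMatrix p (k i) (MvPolynomial.X i) (P i))
    (htr : Matrix.trace (List.ofFn P).prod ∉
      Set.range (MvPolynomial.C : O → MvPolynomial (Fin f) O))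
    (htr' : Matrix.trace (List.ofFn P).prod ∈
      Ideal.span (insert (p : MvPolynomial (Fin f) O)
        (Set.range (MvPolynomial.X : Fin f → MvPolynomial (Fin f) O))))
    (A : Fin f → Matrix (Fin 2) (Fin 2) O)
    (hA : ∀ i a b, (p : O) ∣ A i a b) :
    Matrix.trace
        (List.ofFn fun i =>
          ((1 + A i).map (MvPolynomial.C : O → MvPolynomial (Fin f) O)) * P i).prod ∉
      Set.range (MvPolynomial.C : O → MvPolynomial (Fin f) O) := by
  subst hO
  choose t ht using fun i => (hP i).exists_eq_typeMatrix
  obtain rfl : P = fun i => typeMatrix (t i) _ _ := funext ht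
  exact trace_perturbed_prod_not_constant p (not_isUnit_natCast_integralClosure p E) hf k t
    htr htr' A hA
end

section
/- Let f ≥ 1 and k ≥ 1 be integers, and for each i ∈ {1, …, f} let P_i ∈ M_2(O_E[X_1, …, X_f]) be a matrix of one of the types t1(k, X_i), t2(k, X_i), t3(k, X_i), t4(k, X_i), viewed inside M_2(O_E[[π]][X_1, …, X_f]). Let A_1, …, A_f ∈ M_2(O_E[[π]]) be matrices all of whose entries lie in p·O_E[[π]], and set Q_f := P_1·⋯·P_f and Q_f^A := (Id + A_1)·P_1·(Id + A_2)·P_2·⋯·(Id + A_f)·P_f. Then each Id + A_i is invertible in M_2(O_E[[π]]), the matrix p^{fk}·(Q_f^A)^{−1}, computed in M_2 of the field of fractions of O_E[[π]][X_1, …, X_f], has all its entries in O_E[[π]][X_1, …, X_f], and one has the congruences Q_f^A ≡ Q_f and p^{fk}·(Q_f^A)^{−1} ≡ p^{fk}·Q_f^{−1}, both taken entrywise modulo the ideal of O_E[[π]][X_1, …, X_f] generated by p, X_1, …, X_f. -/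
theorem isUnit_one_add_algebraMap_mul {R S : Type*} [CommRing R] [IsLocalRing R] [CommRing S]
    [Algebra R S] [Algebra.IsIntegral R S] {x : R} (hx : x ∈ IsLocalRing.maximalIdeal R) (y : S) :
    IsUnit (1 + algebraMap R S x * y) := by
  by_contra h
  obtain ⟨m, hm, hmem⟩ := exists_max_ideal_of_mem_nonunits h
  have hc : m.comap (algebraMap R S) = IsLocalRing.maximalIdeal R :=
    IsLocalRing.eq_maximalIdeal (Ideal.isMaximal_comap_of_isIntegral_of_isMaximal m)
  rw [← hc, Ideal.mem_comap] at hx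
  exact hm.ne_top ((Ideal.eq_top_iff_one m).2
    ((Ideal.add_mem_iff_left m (m.mul_mem_right y hx)).1 hmem))

theorem PowerSeries.isUnit_one_add_natCast_mul {p : ℕ} [Fact p.Prime] {S : Type*} [CommRing S]
    [Algebra ℤ_[p] S] [Algebra.IsIntegral ℤ_[p] S] (y : PowerSeries S) :
    IsUnit (1 + (p : PowerSeries S) * y) := by
  rw [PowerSeries.isUnit_iff_constantCoeff]
  have hp : (p : ℤ_[p]) ∈ IsLocalRing.maximalIdeal ℤ_[p] := by
    rw [PadicInt.maximalIdeal_eq_span_p]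
    exact Ideal.mem_span_singleton_self _
  simpa using isUnit_one_add_algebraMap_mul hp (PowerSeries.constantCoeff y)

theorem Matrix.exists_det_one_add_eq {R : Type*} [CommRing R] {a : R}
    {A : Matrix (Fin 2) (Fin 2) R} (hA : ∀ i j, a ∣ A i j) : ∃ y, (1 + A).det = 1 + a * y := by
  choose B hB using hA
  refine ⟨B 0 0 + B 1 1 + a * (B 0 0 * B 1 1 - B 0 1 * B 1 0), ?_⟩
  simp only [Matrix.det_fin_two, Matrix.add_apply, hB]
  simp
  ring

theorem IsTypeMatrix.exists_det_eq {R : Type*} [CommRing R] {p m : ℕ} {x : R}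
    {P : Matrix (Fin 2) (Fin 2) R} (h : IsTypeMatrix p m x P) :
    ∃ ε : R, IsUnit ε ∧ P.det = ε * (p : R) ^ m := by
  rcases h with rfl | rfl | rfl | rfl
  · exact ⟨1, isUnit_one, by simp⟩
  · exact ⟨-1, isUnit_one.neg, by simp⟩
  · exact ⟨1, isUnit_one, by simp⟩
  · exact ⟨-1, isUnit_one.neg, by simp⟩

theorem Matrix.exists_smul_one_of_det_eq {n R : Type*} [Fintype n] [DecidableEq n] [CommRing R]
    {Q : Matrix n n R} {u a : R} (hu : IsUnit u) (hQ : Q.det = u * a) :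
    ∃ M : Matrix n n R, Q * M = a • 1 ∧ M * Q = a • 1 := by
  obtain ⟨u, rfl⟩ := hu
  refine ⟨(↑u⁻¹ : R) • Q.adjugate, ?_, ?_⟩
  · rw [Matrix.mul_smul, Matrix.mul_adjugate, hQ, smul_smul, Units.inv_mul_cancel_left]
  · rw [Matrix.smul_mul, Matrix.adjugate_mul, hQ, smul_smul, Units.inv_mul_cancel_left]

theorem Matrix.smul_eq_adjugate_of_det_eq {n R : Type*} [Fintype n] [DecidableEq n] [CommRing R]
    [IsDomain R] {Q M : Matrix n n R} {u a : R} (ha : a ≠ 0) (hQ : Q.det = u * a)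
    (hM : Q * M = a • 1) : u • M = Q.adjugate := by
  have h : a • (u • M) = a • Q.adjugate := by
    have := congrArg (Q.adjugate * ·) hM
    simpa [← Matrix.mul_assoc, Matrix.adjugate_mul, hQ, smul_smul, mul_comm] using this
  exact smul_right_injective _ ha h

theorem Matrix.det_list_prod_ofFn {n R : Type*} [Fintype n] [DecidableEq n] [CommRing R] {f : ℕ}
    (Q : Fin f → Matrix n n R) : (List.ofFn Q).prod.det = ∏ i, (Q i).det := by
  rw [← Matrix.coe_detMonoidHom, map_list_prod, List.map_ofFn, List.prod_ofFn]
  rfl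

theorem Matrix.map_mk_eq_map_mk_iff {n R : Type*} [CommRing R] {I : Ideal R} {M N : Matrix n n R} :
    M.map (Ideal.Quotient.mk I) = N.map (Ideal.Quotient.mk I) ↔ ∀ i j, (M - N) i j ∈ I := by
  simp [← Matrix.ext_iff, Ideal.Quotient.eq]

section PerturbedProduct

variable {n R : Type*} [Fintype n] [DecidableEq n] [CommRing R] {I : Ideal R} {f k : ℕ} {a : R}
  {B P : Fin f → Matrix n n R} {ε : Fin f → R}

theorem Matrix.det_list_prod_ofFn_eq (hP : ∀ i, (P i).det = ε i * a ^ k) :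
    (List.ofFn P).prod.det = (∏ i, ε i) * a ^ (f * k) := by
  simp [Matrix.det_list_prod_ofFn, hP, Finset.prod_mul_distrib, ← pow_mul, mul_comm f k]

theorem Matrix.det_list_prod_ofFn_mul_eq (hP : ∀ i, (P i).det = ε i * a ^ k) :
    (List.ofFn fun i => B i * P i).prod.det =
      ((∏ i, (B i).det) * ∏ i, ε i) * a ^ (f * k) := by
  rw [Matrix.det_list_prod_ofFn_eq (ε := fun i => (B i).det * ε i) (k := k) (a := a)
    fun i => by rw [Matrix.det_mul, hP, mul_assoc], Finset.prod_mul_distrib]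

theorem Matrix.mapMatrix_mk_list_prod_ofFn_mul
    (hB : ∀ i, (Ideal.Quotient.mk I).mapMatrix (B i) = 1) :
    (Ideal.Quotient.mk I).mapMatrix (List.ofFn fun i => B i * P i).prod =
      (Ideal.Quotient.mk I).mapMatrix (List.ofFn P).prod := by
  rw [map_list_prod, map_list_prod, List.map_ofFn, List.map_ofFn]
  congr 2
  funext i
  simp only [Function.comp_apply, map_mul, hB, one_mul]

theorem Matrix.sub_apply_mem_of_mul_eq_smul_one [IsDomain R] (ha : a ≠ 0)
    (hP : ∀ i, (P i).det = ε i * a ^ k) (hε : ∀ i, IsUnit (ε i))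
    (hB : ∀ i, (Ideal.Quotient.mk I).mapMatrix (B i) = 1) {M M₀ : Matrix n n R}
    (hM : (List.ofFn fun i => B i * P i).prod * M = a ^ (f * k) • 1)
    (hM₀ : (List.ofFn P).prod * M₀ = a ^ (f * k) • 1) (i j : n) : (M - M₀) i j ∈ I := by
  have hdet : Ideal.Quotient.mk I (∏ i, (B i).det) = 1 := by
    simp only [map_prod, RingHom.map_det, hB, Matrix.det_one, Finset.prod_const_one]
  have h := congrArg (Ideal.Quotient.mk I).mapMatrix (Matrix.smul_eq_adjugate_of_det_eq
    (pow_ne_zero _ ha) (Matrix.det_list_prod_ofFn_mul_eq hP) hM)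
  have h₀ := congrArg (Ideal.Quotient.mk I).mapMatrix (Matrix.smul_eq_adjugate_of_det_eq
    (pow_ne_zero _ ha) (Matrix.det_list_prod_ofFn_eq hP) hM₀)
  rw [RingHom.map_adjugate, Matrix.mapMatrix_mk_list_prod_ofFn_mul hB, ← RingHom.map_adjugate,
    ← h₀] at h
  refine Matrix.map_mk_eq_map_mk_iff.1 (Matrix.ext fun i j => ?_) i j
  have hij := congrFun (congrFun h i) j
  simp only [RingHom.mapMatrix_apply, Matrix.map_apply, Matrix.smul_apply, smul_eq_mul, map_mul,
    hdet, one_mul] at hij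
  exact ((IsUnit.prod_univ_iff.2 hε).map (Ideal.Quotient.mk I)).mul_left_cancel hij

end PerturbedProduct

theorem MvPolynomial.mapMatrix_mk_map_C_one_add {σ n S : Type*} [Fintype n] [DecidableEq n]
    [CommRing S] {I : Ideal (MvPolynomial σ S)} {p : ℕ} (hp : (p : MvPolynomial σ S) ∈ I)
    {A : Matrix n n S} (hA : ∀ i j, (p : S) ∣ A i j) :
    (Ideal.Quotient.mk I).mapMatrix ((1 + A).map (MvPolynomial.C : S → MvPolynomial σ S)) = 1 := by
  have h : (MvPolynomial.C (σ := σ)).mapMatrix (1 + A) - 1 = (MvPolynomial.C).mapMatrix A := by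
    rw [map_add, map_one, add_sub_cancel_left]
  rw [← map_one (Ideal.Quotient.mk I).mapMatrix]
  refine Matrix.map_mk_eq_map_mk_iff.2 fun i j => ?_
  obtain ⟨c, hc⟩ := hA i j
  have hij := congrFun (congrFun h i) j
  simp only [RingHom.mapMatrix_apply, Matrix.map_apply, hc, map_mul, map_natCast] at hij
  rw [hij]
  exact I.mul_mem_right _ hp

/-- Let `p` be an odd prime, `E` a finite extension of `ℚ_p`, `O` its ring
of integers.  Let `f ≥ 1` and `k ≥ 1`, and for each `i` let `P i` be a matrix of one of the
types `t1(k, X_i)`, …, `t4(k, X_i)` over `R := O[[π]][X_1, …, X_f]`.  Let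
`A_1, …, A_f ∈ M_2(O[[π]])` have all entries in `p · O[[π]]`, and set `Q_f := P_1 ⋯ P_f` and
`Q_f^A := (Id + A_1)·P_1 ⋯ (Id + A_f)·P_f`.  Then each `Id + A_i` is invertible in
`M_2(O[[π]])`, the matrix `p^{fk} · (Q_f^A)⁻¹` has all its entries in `R` (encoded by the
existence of `M` with `Q_f^A · M = M · Q_f^A = p^{fk} · Id`), and `Q_f^A ≡ Q_f` and
`p^{fk} · (Q_f^A)⁻¹ ≡ p^{fk} · Q_f⁻¹` entrywise modulo the ideal of `R` generated by
`p, X_1, …, X_f` (the matrices `p^{fk} · (Q_f^A)⁻¹` and `p^{fk} · Q_f⁻¹` being encoded by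
any `M`, `M₀` with `Q_f^A · M = p^{fk} · Id` and `Q_f · M₀ = p^{fk} · Id`; such matrices are
unique since `R` is a domain). -/
theorem statement9 (p : ℕ) [Fact p.Prime] (hp : p ≠ 2)
    (E : Type*) [Field E] [Algebra ℚ_[p] E] [FiniteDimensional ℚ_[p] E]
    [Algebra ℤ_[p] E] [IsScalarTower ℤ_[p] ℚ_[p] E]
    (O : Subalgebra ℤ_[p] E) (hO : O = integralClosure ℤ_[p] E)
    (f k : ℕ) (hf : 1 ≤ f) (hk : 1 ≤ k)
    (P : Fin f → Matrix (Fin 2) (Fin 2) (MvPolynomial (Fin f) (PowerSeries O)))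
    (hP : ∀ i, IsTypeMatrix p k (MvPolynomial.X i) (P i))
    (A : Fin f → Matrix (Fin 2) (Fin 2) (PowerSeries O))
    (hA : ∀ i a b, (p : PowerSeries O) ∣ A i a b)
    (I : Ideal (MvPolynomial (Fin f) (PowerSeries O)))
    (hI : I = Ideal.span (insert (p : MvPolynomial (Fin f) (PowerSeries O))
      (Set.range (MvPolynomial.X : Fin f → MvPolynomial (Fin f) (PowerSeries O))))) :
    (∀ i, IsUnit ((1 : Matrix (Fin 2) (Fin 2) (PowerSeries O)) + A i)) ∧
    (∃ M : Matrix (Fin 2) (Fin 2) (MvPolynomial (Fin f) (PowerSeries O)),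
      (List.ofFn fun i =>
          ((1 + A i).map (MvPolynomial.C : PowerSeries O → MvPolynomial (Fin f) (PowerSeries O)))
            * P i).prod * M =
        ((p : MvPolynomial (Fin f) (PowerSeries O)) ^ (f * k)) • 1 ∧
      M * (List.ofFn fun i =>
          ((1 + A i).map (MvPolynomial.C : PowerSeries O → MvPolynomial (Fin f) (PowerSeries O)))
            * P i).prod =
        ((p : MvPolynomial (Fin f) (PowerSeries O)) ^ (f * k)) • 1) ∧
    (∀ i j : Fin 2,
      (((List.ofFn fun i =>
          ((1 + A i).map (MvPolynomial.C : PowerSeries O → MvPolynomial (Fin f) (PowerSeries O)))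
            * P i).prod - (List.ofFn P).prod :
        Matrix (Fin 2) (Fin 2) (MvPolynomial (Fin f) (PowerSeries O))) i j) ∈ I) ∧
    (∀ M M₀ : Matrix (Fin 2) (Fin 2) (MvPolynomial (Fin f) (PowerSeries O)),
      (List.ofFn fun i =>
          ((1 + A i).map (MvPolynomial.C : PowerSeries O → MvPolynomial (Fin f) (PowerSeries O)))
            * P i).prod * M =
        ((p : MvPolynomial (Fin f) (PowerSeries O)) ^ (f * k)) • 1 →
      (List.ofFn P).prod * M₀ =
        ((p : MvPolynomial (Fin f) (PowerSeries O)) ^ (f * k)) • 1 →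
      ∀ i j : Fin 2,
        ((M - M₀ : Matrix (Fin 2) (Fin 2) (MvPolynomial (Fin f) (PowerSeries O))) i j) ∈ I) := by
  subst hO
  choose y hy using fun i => Matrix.exists_det_one_add_eq (hA i)
  choose ε hε hdetP using fun i => (hP i).exists_det_eq
  have hunit (i : Fin f) : IsUnit (1 + A i).det :=
    hy i ▸ PowerSeries.isUnit_one_add_natCast_mul (y i)
  have hBu (i : Fin f) : IsUnit ((1 + A i).map (MvPolynomial.C :
      _ → MvPolynomial (Fin f) (PowerSeries (integralClosure ℤ_[p] E)))).det := by
    have h := (hunit i).map (MvPolynomial.C (σ := Fin f))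
    rwa [RingHom.map_det] at h
  have hpI : (p : MvPolynomial (Fin f) (PowerSeries (integralClosure ℤ_[p] E))) ∈ I :=
    hI ▸ Ideal.subset_span (Set.mem_insert _ _)
  have hp0 : (p : MvPolynomial (Fin f) (PowerSeries (integralClosure ℤ_[p] E))) ≠ 0 := by
    have : CharZero E := charZero_of_injective_algebraMap (algebraMap ℚ_[p] E).injective
    have hE : (p : E) ≠ 0 := Nat.cast_ne_zero.2 (Fact.out : p.Prime).ne_zero
    refine fun h => hE ?_
    simpa using congrArg (fun q => algebraMap (integralClosure ℤ_[p] E) E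
      (PowerSeries.constantCoeff (MvPolynomial.constantCoeff q))) h
  have hBI := fun i => MvPolynomial.mapMatrix_mk_map_C_one_add hpI (hA i)
  exact ⟨fun i => (Matrix.isUnit_iff_isUnit_det _).2 (hunit i),
    Matrix.exists_smul_one_of_det_eq
      ((IsUnit.prod_univ_iff.2 hBu).mul (IsUnit.prod_univ_iff.2 hε))
      (Matrix.det_list_prod_ofFn_mul_eq hdetP),
    Matrix.map_mk_eq_map_mk_iff.1 (Matrix.mapMatrix_mk_list_prod_ofFn_mul hBI),
    fun M M₀ hM hM₀ => Matrix.sub_apply_mem_of_mul_eq_smul_one hp0 hdetP hε hBI hM hM₀⟩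
end
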